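/- arXiv:1310.6341 — 3 statements merged into one kernel-verified Lean document; each statement's English description precedes it below -/
import Mathlib

section
/- Let Λ be a free ℤ-module of finite rank equipped with a nondegenerate symmetric ℤ-bilinear form B, let n ≥ 2 be an integer, and let v, a ∈ Λ with B(v,v) = 2n−2 and B(a,v) = n−1. Assume v is primitive, i.e. whenever v = c·w with c ∈ ℤ and w ∈ Λ, c is a unit. Then there is no u ∈ Λ with B(u,v) = 0 such that B(u,w) = B(a,w) for every w ∈ Λ with B(w,v) = 0. (Equivalently, the functional on v⊥ given by pairing with a is not represented by an element of v⊥; together with the previous divisibility statement this says the class R = a − v/2 has order exactly 2 in the discriminant group of v⊥, as asserted in Lemma 5.6.) -/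
/-- For a nondegenerate lattice `(Λ, B)` of finite rank, `v` primitive with
`B(v,v) = 2n-2` (`n ≥ 2`) and `a` with `B(a,v) = n-1`, the functional on `v⊥`
given by pairing with `a` is not represented by an element of `v⊥`. -/
theorem stmt_4 (Λ : Type*) [AddCommGroup Λ] [Module ℤ Λ]
    [Module.Free ℤ Λ] [Module.Finite ℤ Λ]
    (B : LinearMap.BilinForm ℤ Λ) (hsym : ∀ x y : Λ, B x y = B y x)
    (hnd : ∀ x : Λ, (∀ y : Λ, B x y = 0) → x = 0)
    (n : ℤ) (hn : 2 ≤ n) (v a : Λ)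
    (hv : B v v = 2 * n - 2) (hav : B a v = n - 1)
    (hprim : ∀ (c : ℤ) (w : Λ), v = c • w → IsUnit c) :
    ¬∃ u : Λ, B u v = 0 ∧ ∀ w : Λ, B w v = 0 → B u w = B a w := by
  rintro ⟨u, huv, hu⟩
  have two_smul_eq : v = (2 : ℤ) • (a - u) := by
    rw [← sub_eq_zero]
    refine hnd _ fun y => ?_
    have h := hu ((2 * n - 2) • y - B y v • v) (by
      simp only [map_sub, map_zsmul, LinearMap.sub_apply, LinearMap.smul_apply, smul_eq_mul, hv]
      ring)
    simp only [map_sub, map_zsmul, smul_eq_mul, huv, hav] at h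
    simp only [map_sub, map_zsmul, LinearMap.sub_apply, LinearMap.smul_apply, smul_eq_mul]
    rw [hsym v y]
    refine (mul_eq_zero.mp ?_).resolve_left (show n - 1 ≠ 0 by omega)
    linear_combination h
  exact absurd (hprim 2 _ two_smul_eq) (by decide)
end

section
/- Let 𝒜 be an abelian category, let A and B be simple objects of 𝒜, let y be a natural number, and suppose there is a short exact sequence 0 → A → E → B^{⊕y} → 0, where B^{⊕y} denotes the biproduct of y copies of B, such that every morphism B → E is zero. Then every proper quotient of E is isomorphic to B^{⊕z} for some natural number z; that is, for every short exact sequence 0 → K → E → Q → 0 with K ≠ 0, the object Q is isomorphic to a biproduct of copies of B. (Case (i) of Lemma 4.7, quoted from Lemma 6.9 of Bayer–Macrì.) -/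
open CategoryTheory CategoryTheory.Limits

attribute [local instance] CategoryTheory.Limits.HasFiniteBiproducts.of_hasFiniteProducts

/-- Adjoining one more summand to a finite biproduct of copies of `B`. -/
noncomputable def biproductFinSuccIso {C : Type*} [Category C] [Abelian C] (B : C) (z : ℕ) :
    (⨁ (fun _ : Fin z => B)) ⊞ B ≅ ⨁ (fun _ : Fin (z + 1) => B) where
  hom := biprod.desc (biproduct.desc fun i => biproduct.ι (fun _ : Fin (z + 1) => B) i.succ)
    (biproduct.ι (fun _ : Fin (z + 1) => B) 0)
  inv := biproduct.desc (Fin.cases biprod.inr fun i =>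
    biproduct.ι (fun _ : Fin z => B) i ≫ biprod.inl)
  hom_inv_id := by
    apply biprod.hom_ext'
    · apply biproduct.hom_ext'
      intro i
      simp
    · simp
  inv_hom_id := by
    apply biproduct.hom_ext'
    intro i
    refine Fin.cases ?_ (fun i => ?_) i <;> simp

/-- A monomorphism `u` and a morphism `v` from a simple object that does not vanish modulo `u`
are jointly monic. -/
lemma mono_biprod_desc_of_simple {C : Type*} [Category C] [Abelian C] {X B Q : C} [Simple B]
    (u : X ⟶ Q) [Mono u] (v : B ⟶ Q) (hv : v ≫ cokernel.π u ≠ 0) : Mono (biprod.desc u v) := by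
  have : Mono (v ≫ cokernel.π u) := mono_of_nonzero_from_simple hv
  refine Preadditive.mono_of_cancel_zero _ fun {T} x hx => ?_
  have hsum : (x ≫ biprod.fst) ≫ u + (x ≫ biprod.snd) ≫ v = 0 := by
    simpa [biprod.desc_eq] using hx
  have hsnd : x ≫ biprod.snd = 0 := by
    rw [← cancel_mono (v ≫ cokernel.π u)]
    simpa using hsum =≫ cokernel.π u
  have hfst : x ≫ biprod.fst = 0 := by
    rw [← cancel_mono u]
    simpa [hsnd] using hsum
  apply biprod.hom_ext <;> simp [hfst, hsnd]

/-- An epimorphism out of a finite biproduct of copies of a simple object `B` restricts to an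
isomorphism along some morphism from a finite biproduct of copies of `B`. -/
lemma exists_isIso_comp_of_epi_biproduct_simple {C : Type*} [Category C] [Abelian C] {B Q : C}
    [Simple B] {y : ℕ} (q : (⨁ (fun _ : Fin y => B)) ⟶ Q) [Epi q] :
    ∃ (z : ℕ) (m : (⨁ (fun _ : Fin z => B)) ⟶ ⨁ (fun _ : Fin y => B)), IsIso (m ≫ q) := by
  have key : ∀ t : Finset (Fin y), ∃ (z : ℕ)
      (m : (⨁ (fun _ : Fin z => B)) ⟶ ⨁ (fun _ : Fin y => B)), Mono (m ≫ q) ∧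
        ∀ j ∈ t, ∃ c, biproduct.ι (fun _ : Fin y => B) j ≫ q = c ≫ m ≫ q := by
    intro t
    induction t using Finset.induction_on with
    | empty =>
      refine ⟨0, 0, Preadditive.mono_of_cancel_zero _ fun x _ => ?_, by simp⟩
      apply biproduct.hom_ext
      exact fun i => i.elim0
    | insert j t _ ih =>
      obtain ⟨z, m, hm, ht⟩ := ih
      by_cases hj : (biproduct.ι (fun _ : Fin y => B) j ≫ q) ≫ cokernel.π (m ≫ q) = 0
      · refine ⟨z, m, hm, fun k hk => ?_⟩
        rcases Finset.mem_insert.1 hk with rfl | hk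
        · exact ⟨Abelian.monoLift (m ≫ q) _ hj, (Abelian.monoLift_comp (m ≫ q) _ hj).symm⟩
        · exact ht k hk
      · have hmono := mono_biprod_desc_of_simple (m ≫ q) _ hj
        have hcomp : ((biproductFinSuccIso B z).inv ≫
            biprod.desc m (biproduct.ι (fun _ : Fin y => B) j)) ≫ q =
            (biproductFinSuccIso B z).inv ≫
              biprod.desc (m ≫ q) (biproduct.ι (fun _ : Fin y => B) j ≫ q) := by
          rw [Category.assoc]
          congr 1
          apply biprod.hom_ext' <;> simp
        refine ⟨z + 1, (biproductFinSuccIso B z).inv ≫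
          biprod.desc m (biproduct.ι (fun _ : Fin y => B) j), ?_, fun k hk => ?_⟩
        · rw [hcomp]
          infer_instance
        · rw [hcomp]
          rcases Finset.mem_insert.1 hk with rfl | hk
          · exact ⟨biprod.inr ≫ (biproductFinSuccIso B z).hom, by simp⟩
          · obtain ⟨c, hc⟩ := ht k hk
            exact ⟨c ≫ biprod.inl ≫ (biproductFinSuccIso B z).hom, by simp [hc]⟩
  obtain ⟨z, m, hm, h⟩ := key Finset.univ
  have hπ : q ≫ cokernel.π (m ≫ q) = 0 := by
    apply biproduct.hom_ext'
    intro j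
    obtain ⟨c, hc⟩ := h j (Finset.mem_univ j)
    rw [reassoc_of% hc, comp_zero]
    rw [← Category.assoc m, cokernel.condition, comp_zero]
  have : Epi (m ≫ q) := Preadditive.epi_of_cokernel_zero (zero_of_epi_comp q hπ)
  exact ⟨z, m, isIso_of_mono_of_epi _⟩

/-- A subobject of a finite biproduct of copies of a simple object is a retract. -/
lemma isSplitMono_of_mono_biproduct_simple {C : Type*} [Category C] [Abelian C] {B K : C}
    [Simple B] {y : ℕ} (j : K ⟶ ⨁ (fun _ : Fin y => B)) [Mono j] : IsSplitMono j := by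
  obtain ⟨z, m, hm⟩ := exists_isIso_comp_of_epi_biproduct_simple (cokernel.π j)
  have hs : (inv (m ≫ cokernel.π j) ≫ m) ≫ cokernel.π j = 𝟙 _ := by simp
  generalize inv (m ≫ cokernel.π j) ≫ m = s at hs
  have h : (𝟙 _ - cokernel.π j ≫ s) ≫ cokernel.π j = 0 := by simp [hs]
  refine ⟨⟨⟨Abelian.monoLift j _ h, ?_⟩⟩⟩
  rw [← cancel_mono j, Category.assoc, Abelian.monoLift_comp]
  simp

/-- Lemma 6.9(i) of Bayer–Macrì: given a short exact sequence `0 → A → E → B^y → 0`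
with `A`, `B` simple and `Hom(B, E) = 0`, every proper quotient of `E` is isomorphic
to a biproduct of copies of `B`. -/
theorem stmt_6 (𝒜 : Type*) [Category 𝒜] [Abelian 𝒜]
    (A B E : 𝒜) [Simple A] [Simple B] (y : ℕ)
    (f : A ⟶ E) (g : E ⟶ ⨁ (fun _ : Fin y => B)) (w : f ≫ g = 0)
    (hse : (CategoryTheory.ShortComplex.mk f g w).ShortExact)
    (hhom : ∀ φ : B ⟶ E, φ = 0) :
    ∀ (K Q : 𝒜) (i : K ⟶ E) (p : E ⟶ Q) (w' : i ≫ p = 0),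
      (CategoryTheory.ShortComplex.mk i p w').ShortExact → ¬IsZero K →
        ∃ z : ℕ, Nonempty (Q ≅ ⨁ (fun _ : Fin z => B)) := by
  intro K Q i p w' hse' hK
  have : Mono f := hse.mono_f
  have : Mono i := hse'.mono_f
  have : Epi g := hse.epi_g
  have : Epi p := hse'.epi_g
  by_cases hfp : f ≫ p = 0
  · let q : (⨁ (fun _ : Fin y => B)) ⟶ Q := hse.exact.desc p hfp
    have hq : g ≫ q = p := hse.exact.g_desc p hfp
    have : Epi q := epi_of_epi_fac hq
    obtain ⟨z, m, hm⟩ := exists_isIso_comp_of_epi_biproduct_simple q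
    exact ⟨z, ⟨(asIso (m ≫ q)).symm⟩⟩
  · have : Mono (f ≫ p) := mono_of_nonzero_from_simple hfp
    have : Mono (i ≫ g) := by
      refine Preadditive.mono_of_cancel_zero _ fun {T} x hx => ?_
      obtain ⟨a, ha⟩ : ∃ a : T ⟶ A, a ≫ f = x ≫ i :=
        ⟨hse.exact.lift (x ≫ i) (by simpa using hx), hse.exact.lift_f _ _⟩
      have ha0 : a = 0 := by
        rw [← cancel_mono (f ≫ p), reassoc_of% ha, w']
        simp
      rw [← cancel_mono i, ← ha, ha0]
      simp
    have := isSplitMono_of_mono_biproduct_simple (i ≫ g)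
    have hr : retraction (i ≫ g) = 0 := by
      apply biproduct.hom_ext'
      intro k
      rw [← cancel_mono i, hhom ((_ ≫ _) ≫ i), comp_zero, zero_comp]
    refine absurd ((IsZero.iff_id_eq_zero K).2 ?_) hK
    rw [← IsSplitMono.id (i ≫ g), hr, comp_zero]
end

section
/- Let 𝒜 be an abelian category, let A and B be simple objects of 𝒜, let x be a natural number, and suppose there is a short exact sequence 0 → A^{⊕x} → E → B → 0, where A^{⊕x} denotes the biproduct of x copies of A, such that every morphism E → A is zero. Then every proper subobject of E is isomorphic to A^{⊕z} for some natural number z; that is, for every monomorphism S → E that is not an isomorphism, the object S is isomorphic to a biproduct of copies of A. (Case (ii) of Lemma 4.7, quoted from Lemma 6.9 of Bayer–Macrì.) -/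
open CategoryTheory CategoryTheory.Limits

attribute [local instance] CategoryTheory.Limits.HasFiniteBiproducts.of_hasFiniteProducts

/-- A subobject of a finite power of a simple object projects isomorphically onto a finite power
of that object; in particular it is a direct summand. -/
theorem exists_isIso_comp_of_mono_to_biproduct {𝒜 : Type*} [Category 𝒜] [Abelian 𝒜]
    {A : 𝒜} [Simple A] {n : ℕ} {S : 𝒜} (i : S ⟶ ⨁ (fun _ : Fin n => A)) [Mono i] :
    ∃ (m : ℕ) (q : (⨁ (fun _ : Fin n => A)) ⟶ ⨁ (fun _ : Fin m => A)), IsIso (i ≫ q) := by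
  classical
  have hex : ∃ m : ℕ, ∃ q : (⨁ (fun _ : Fin n => A)) ⟶ ⨁ (fun _ : Fin m => A), Mono (i ≫ q) :=
    ⟨n, 𝟙 _, by rw [Category.comp_id]; infer_instance⟩
  obtain ⟨m, ⟨q, hq⟩, hmin⟩ : ∃ m : ℕ,
      (∃ q : (⨁ (fun _ : Fin n => A)) ⟶ ⨁ (fun _ : Fin m => A), Mono (i ≫ q)) ∧
      ∀ k < m, ¬ ∃ q : (⨁ (fun _ : Fin n => A)) ⟶ ⨁ (fun _ : Fin k => A), Mono (i ≫ q) :=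
    ⟨Nat.find hex, Nat.find_spec hex, fun k hk => Nat.find_min hex hk⟩
  refine ⟨m, q, ?_⟩
  suffices Epi (i ≫ q) from isIso_of_mono_of_epi _
  refine Preadditive.epi_of_cancel_zero _ fun {Z} h hh => ?_
  refine biproduct.hom_ext' _ _ fun t => ?_
  rw [comp_zero]
  obtain _ | m := m
  · exact t.elim0
  -- The kernel of the projection forgetting the coordinate `t` maps isomorphically to that copy.
  let d : (⨁ (fun _ : Fin (m + 1) => A)) ⟶ ⨁ (fun _ : Fin m => A) :=
    biproduct.lift fun j => biproduct.π (fun _ : Fin (m + 1) => A) (t.succAbove j)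
  let k := kernel.ι (i ≫ q ≫ d)
  have hk : k ≠ 0 := fun h0 => hmin m m.lt_succ_self
    ⟨q ≫ d, Preadditive.mono_of_kernel_zero h0⟩
  have hcoord : k ≫ i ≫ q = (k ≫ i ≫ q ≫ biproduct.π _ t) ≫
      biproduct.ι (fun _ : Fin (m + 1) => A) t := by
    refine biproduct.hom_ext _ _ fun j => ?_
    rcases eq_or_ne j t with rfl | hj
    · simp
    · obtain ⟨j, rfl⟩ := Fin.exists_succAbove_eq hj
      have h1 : k ≫ i ≫ q ≫ biproduct.π _ (t.succAbove j) = 0 := by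
        have hd : d ≫ biproduct.π _ j = biproduct.π _ (t.succAbove j) := biproduct.lift_π _ _
        have hkd : k ≫ i ≫ q ≫ d = 0 := kernel.condition _
        rw [← hd, reassoc_of% hkd, zero_comp]
      simp [biproduct.ι_π_ne _ hj.symm, h1]
  let c := k ≫ i ≫ q ≫ biproduct.π (fun _ : Fin (m + 1) => A) t
  have hc : Mono c := by
    have : Mono (c ≫ biproduct.ι (fun _ : Fin (m + 1) => A) t) := by
      rw [← hcoord]; infer_instance
    exact mono_of_mono c (biproduct.ι (fun _ : Fin (m + 1) => A) t)
  have hc0 : c ≠ 0 := fun h0 => hk <| by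
    rw [← cancel_mono (i ≫ q), hcoord, zero_comp]
    exact (congrArg (· ≫ _) h0).trans zero_comp
  have := isIso_of_mono_of_nonzero hc0
  have hct : c ≫ biproduct.ι (fun _ : Fin (m + 1) => A) t = k ≫ i ≫ q := hcoord.symm
  rw [← cancel_epi c, reassoc_of% hct, ← Category.assoc i q h, hh, comp_zero, comp_zero]

/-- A quotient of a finite power of a simple object without nonzero morphisms to that object
is zero. -/
theorem eq_zero_of_epi_from_biproduct {𝒜 : Type*} [Category 𝒜] [Abelian 𝒜]
    {A : 𝒜} [Simple A] {n : ℕ} {Q : 𝒜} (p : (⨁ (fun _ : Fin n => A)) ⟶ Q) [Epi p]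
    (h : ∀ φ : Q ⟶ A, φ = 0) : p = 0 := by
  obtain ⟨m, q, hq⟩ := exists_isIso_comp_of_mono_to_biproduct (kernel.ι p)
  let r := q ≫ inv (kernel.ι p ≫ q)
  have hr : kernel.ι p ≫ r = 𝟙 _ := by
    rw [← Category.assoc, IsIso.hom_inv_id]
  let e := 𝟙 (⨁ (fun _ : Fin n => A)) - r ≫ kernel.ι p
  have he : kernel.ι p ≫ e = 0 := by
    simp [e, Preadditive.comp_sub, reassoc_of% hr]
  have hs : Abelian.epiDesc p e he = 0 :=
    biproduct.hom_ext _ _ fun j => (h _).trans zero_comp.symm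
  have he0 : e = 0 := by rw [← Abelian.comp_epiDesc p e he, hs, comp_zero]
  have hep : e ≫ p = p := by simp [e, Preadditive.sub_comp]
  rw [← hep, he0, zero_comp]

/-- Lemma 6.9(ii) of Bayer–Macrì: given a short exact sequence `0 → A^x → E → B → 0`
with `A`, `B` simple and `Hom(E, A) = 0`, every proper subobject of `E` is isomorphic
to a biproduct of copies of `A`. -/
theorem stmt_7 (𝒜 : Type*) [Category 𝒜] [Abelian 𝒜]
    (A B E : 𝒜) [Simple A] [Simple B] (x : ℕ)
    (f : (⨁ (fun _ : Fin x => A)) ⟶ E) (g : E ⟶ B) (w : f ≫ g = 0)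
    (hse : (CategoryTheory.ShortComplex.mk f g w).ShortExact)
    (hhom : ∀ φ : E ⟶ A, φ = 0) :
    ∀ (S : 𝒜) (i : S ⟶ E), Mono i → ¬IsIso i →
      ∃ z : ℕ, Nonempty (S ≅ ⨁ (fun _ : Fin z => A)) := by
  intro S i hi hni
  have hf : Mono f := hse.mono_f
  have hg : Epi g := hse.epi_g
  by_cases hig : i ≫ g = 0
  · let l : S ⟶ ⨁ (fun _ : Fin x => A) := hse.exact.lift i hig
    have hl : l ≫ f = i := hse.exact.lift_f i hig
    have : Mono (l ≫ f) := by rw [hl]; exact hi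
    have : Mono l := mono_of_mono l f
    obtain ⟨z, q, hq⟩ := exists_isIso_comp_of_mono_to_biproduct l
    exact ⟨z, ⟨asIso (l ≫ q)⟩⟩
  · have hepi : Epi (i ≫ g) := epi_of_nonzero_to_simple hig
    have hdesc : ∀ {Z : 𝒜} (u : E ⟶ Z), f ≫ u = 0 → i ≫ u = 0 → u = 0 := by
      intro Z u hfu hiu
      have hv : g ≫ hse.exact.desc u hfu = u := hse.exact.g_desc u hfu
      have : hse.exact.desc u hfu = 0 := by
        rw [← cancel_epi (i ≫ g), Category.assoc, hv, hiu, comp_zero]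
      rw [← hv, this, comp_zero]
    have hp : Epi (f ≫ cokernel.π i) := by
      refine Preadditive.epi_of_cancel_zero _ fun {Z} h hh => ?_
      rw [← cancel_epi (cokernel.π i), comp_zero]
      exact hdesc _ (by simpa using hh) (by simp)
    have hp0 : f ≫ cokernel.π i = 0 := eq_zero_of_epi_from_biproduct _ fun φ => by
      rw [← cancel_epi (cokernel.π i), comp_zero]
      exact hhom _
    have : Epi i := Preadditive.epi_of_cokernel_zero (hdesc _ hp0 (cokernel.condition i))
    exact absurd (isIso_of_mono_of_epi i) hni
end
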